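/- arXiv:1907.06532 — 4 statements merged into one kernel-verified Lean document; each statement's English description precedes it below -/
import Mathlib

section
/- Let Δ: v_1, F_1, v_2, F_2, …, v_{2s+1}, F_{2s+1}, v_{2s+2} = v_1 be a special odd cycle with s ≥ 1 and I = I(Δ) its facet ideal. Let u = ∏_{i=1}^{2s+1} ( x_{v_i} · ∏_{j ∈ F_i ∖ {v_i, v_{i+1}}} x_j ). Then u ∈ I^s but u ∉ I^{s+1}. -/
open MvPolynomial

/-- If each product `f (2k) * f (2k+1)` lies in `I`, then the product of the first `2s` terms lies
in `I ^ s`. -/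
theorem Ideal.prod_range_two_mul_mem_pow {R : Type*} [CommRing R] (I : Ideal R) (f : ℕ → R)
    (hf : ∀ k, f (2 * k) * f (2 * k + 1) ∈ I) (s : ℕ) :
    ∏ i ∈ Finset.range (2 * s), f i ∈ I ^ s := by
  induction s with
  | zero => simp
  | succ s ih =>
    rw [show 2 * (s + 1) = 2 * s + 1 + 1 by ring, Finset.prod_range_succ, Finset.prod_range_succ,
      mul_assoc, pow_succ]
    exact Ideal.mul_mem_mul ih (hf s)

/-- A product over a finset, with two distinct elements split off. -/
theorem Finset.prod_eq_mul_mul_prod_sdiff_pair {α M : Type*} [DecidableEq α] [CommMonoid M]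
    {t : Finset α} {a b : α} (ha : a ∈ t) (hb : b ∈ t) (hab : a ≠ b) (g : α → M) :
    ∏ j ∈ t, g j = g a * g b * ∏ j ∈ t \ {a, b}, g j := by
  rw [← Finset.prod_pair hab, mul_comm, Finset.prod_sdiff]
  simp [Finset.insert_subset_iff, ha, hb]

/-- **Theorem (Step 1, part 1).** For a special odd cycle
`Δ : v_1, F_1, …, v_{2s+1}, F_{2s+1}, v_{2s+2} = v_1` with `s ≥ 1`, facet ideal
`I = I(Δ)`, and `u = ∏_{i=1}^{2s+1} ( x_{v_i} ∏_{j ∈ F_i ∖ {v_i,v_{i+1}}} x_j )`,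
one has `u ∈ I^s` and `u ∉ I^{s+1}`. -/
theorem specialOddCycle_monomial_not_in_power {K : Type*} [Field K] (n s : ℕ) (hs : 1 ≤ s)
    (F : Fin (2 * s + 1) → Finset (Fin n)) (v : Fin (2 * s + 1) → Fin n)
    (hFinj : Function.Injective F)
    (hFcover : ∀ a : Fin n, ∃ i, a ∈ F i)
    (hFincomp : ∀ i j, i ≠ j → ¬ F i ⊆ F j)
    (hvinj : Function.Injective v)
    (hvF : ∀ i, v i ∈ F i ∧ v (i + 1) ∈ F i)
    (hspecial : ∀ i, (Finset.univ.filter fun j => v j ∈ F i).card ≤ 2)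
    (I : Ideal (MvPolynomial (Fin n) K))
    (hI : I = Ideal.span (Set.range fun i => ∏ j ∈ F i, (X j : MvPolynomial (Fin n) K)))
    (u : MvPolynomial (Fin n) K)
    (hu : u = ∏ i : Fin (2 * s + 1),
        ((X (v i) : MvPolynomial (Fin n) K) * ∏ j ∈ F i \ {v i, v (i + 1)}, X j)) :
    u ∈ I ^ s ∧ u ∉ I ^ (s + 1) := by
  have hne (i : Fin (2 * s + 1)) : i ≠ i + 1 := by
    simp
    omega
  have hfac {M : Type _} [CommMonoid M] (i : Fin (2 * s + 1)) (g : Fin n → M) :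
      ∏ j ∈ F i, g j = g (v i) * g (v (i + 1)) * ∏ j ∈ F i \ {v i, v (i + 1)}, g j :=
    Finset.prod_eq_mul_mul_prod_sdiff_pair (hvF i).1 (hvF i).2 (hvinj.ne (hne i)) g
  constructor
  · set g : Fin (2 * s + 1) → MvPolynomial (Fin n) K :=
      fun i => X (v i) * ∏ j ∈ F i \ {v i, v (i + 1)}, X j with hg
    have hu' : u = ∏ m ∈ Finset.range (2 * s + 1), g (Fin.ofNat (2 * s + 1) m) := by
      rw [hu, Finset.prod_range]
      exact Finset.prod_congr rfl fun i _ => by simp [hg]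
    rw [hu', Finset.prod_range_succ]
    refine Ideal.mul_mem_right _ _ (Ideal.prod_range_two_mul_mem_pow I _ (fun k => ?_) s)
    set i := Fin.ofNat (2 * s + 1) (2 * k)
    have hi : Fin.ofNat (2 * s + 1) (2 * k + 1) = i + 1 := by
      ext
      simp [i, Fin.val_add]
    rw [hi]
    have hmem : ∏ j ∈ F i, (X j : MvPolynomial (Fin n) K) ∈ I :=
      hI ▸ Ideal.subset_span ⟨i, rfl⟩
    convert Ideal.mul_mem_right
      (∏ j ∈ F (i + 1) \ {v (i + 1), v (i + 1 + 1)}, (X j : MvPolynomial (Fin n) K)) I hmem using 1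
    rw [hfac i]
    simp only [hg]
    ring
  · intro hmem
    classical
    set w : Fin n → Polynomial K :=
      fun a => if a ∈ Set.range v then Polynomial.X else 1 with hw
    have hwv (i) : w (v i) = Polynomial.X := by simp [hw]
    have hrest (i) : ∏ j ∈ F i \ {v i, v (i + 1)}, w j = 1 := by
      refine Finset.prod_eq_one fun j hj => if_neg ?_
      rintro ⟨k, rfl⟩
      simp only [Finset.mem_sdiff, Finset.mem_insert, Finset.mem_singleton, hvinj.eq_iff,
        not_or] at hj
      have hsub : {k, i, i + 1} ⊆ Finset.univ.filter fun j => v j ∈ F i := by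
        simp [Finset.insert_subset_iff, hj.1, hvF i]
      have hcard : ({k, i, i + 1} : Finset (Fin (2 * s + 1))).card = 3 :=
        Finset.card_eq_three.mpr ⟨k, i, i + 1, hj.2.1, hj.2.2, hne i, rfl⟩
      have := Finset.card_le_card hsub
      have := hspecial i
      omega
    have hImap : I.map (aeval (R := K) w) ≤ Ideal.span {(Polynomial.X : Polynomial K) ^ 2} := by
      rw [hI, Ideal.map_span, Ideal.span_le]
      rintro _ ⟨_, ⟨i, rfl⟩, rfl⟩
      have : aeval (R := K) w (∏ j ∈ F i, X j) = Polynomial.X ^ 2 := by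
        simp only [map_prod, aeval_X]
        rw [hfac i, hrest, hwv, hwv, mul_one, sq]
      exact this ▸ Ideal.mem_span_singleton_self _
    have hdeg := Ideal.mem_map_of_mem (aeval (R := K) w) hmem
    rw [Ideal.map_pow] at hdeg
    have hdvd := Ideal.pow_right_mono hImap (s + 1) hdeg
    have huw : aeval (R := K) w u = Polynomial.X ^ (2 * s + 1) := by
      simp [hu, map_prod, hwv, hrest]
    rw [Ideal.span_singleton_pow, Ideal.mem_span_singleton, huw, ← pow_mul,
      pow_dvd_pow_iff Polynomial.X_ne_zero Polynomial.not_isUnit_X] at hdvd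
    omega
end

section
/- Let Δ: v_1, F_1, v_2, F_2, …, v_{2s+1}, F_{2s+1}, v_{2s+2} = v_1 be a special odd cycle with s ≥ 1 and I = I(Δ) its facet ideal. Let u = ∏_{i=1}^{2s+1} ( x_{v_i} · ∏_{j ∈ F_i ∖ {v_i, v_{i+1}}} x_j ). Then the colon ideal I^{s+1} : u equals the prime ideal P = (x_{v_1},…,x_{v_{2s+1}}); in particular P ∈ Ass(I^{s+1}). -/
open MvPolynomial

/-- A product over `2 * s + 1` consecutive indices splits into its even and odd parts. -/
lemma prod_range_two_mul_add_one {M : Type*} [CommMonoid M] (a : ℕ → M) (s : ℕ) :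
    ∏ k ∈ Finset.range (2 * s + 1), a k =
      (∏ k ∈ Finset.range (s + 1), a (2 * k)) * ∏ k ∈ Finset.range s, a (2 * k + 1) := by
  induction s with
  | zero => simp
  | succ s ih =>
    rw [show 2 * (s + 1) + 1 = (2 * s + 1) + 1 + 1 by ring, Finset.prod_range_succ,
      Finset.prod_range_succ, ih, Finset.prod_range_succ _ (s + 1), Finset.prod_range_succ _ s,
      Finset.prod_range_succ (fun k => a (2 * k + 1)) s,
      show 2 * s + 1 + 1 = 2 * (s + 1) by ring]
    ac_rfl

lemma Fin.val_nsmul_one {N : ℕ} [NeZero N] (k : ℕ) : ((k • (1 : Fin N) : Fin N) : ℕ) = k % N := by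
  induction k with
  | zero => simp
  | succ k ih => rw [succ_nsmul, Fin.val_add, ih, Fin.val_one', ← Nat.add_mod]

/-- A product over a cyclic index set may be started at any point of the cycle. -/
lemma prod_fin_eq_prod_range_add {M : Type*} [CommMonoid M] {N : ℕ} [NeZero N]
    (h : Fin N → M) (i : Fin N) :
    ∏ j, h j = ∏ k ∈ Finset.range N, h (i + k • (1 : Fin N)) := by
  rw [Finset.prod_range (fun k => h (i + k • (1 : Fin N))), ← Equiv.prod_comp (Equiv.addLeft i)]
  refine Finset.prod_congr rfl fun j _ => ?_
  rw [Equiv.coe_addLeft, show (j : ℕ) • (1 : Fin N) = j from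
    Fin.ext (by rw [Fin.val_nsmul_one, Nat.mod_eq_of_lt j.isLt])]

/-- On a cycle of length `2 * s + 1` with vertex weights `x` and edge weights `g`, the total weight
times the weight of one vertex is a multiple of a product of `s + 1` weighted edges. -/
lemma prod_edges_dvd_mul_prod {M : Type*} [CommMonoid M] (s : ℕ)
    (x g : Fin (2 * s + 1) → M) (i : Fin (2 * s + 1)) :
    (∏ k ∈ Finset.range (s + 1), (x (i + (2 * k) • (1 : Fin (2 * s + 1))) *
        x (i + (2 * k) • (1 : Fin (2 * s + 1)) + 1) * g (i + (2 * k) • (1 : Fin (2 * s + 1))))) ∣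
      x i * ∏ j, x j * g j := by
  have hcycle : x i = x (i + (2 * s + 1) • (1 : Fin (2 * s + 1))) := by
    rw [show (2 * s + 1) • (1 : Fin (2 * s + 1)) = 0 from
      Fin.ext (by rw [Fin.val_nsmul_one, Nat.mod_self, Fin.val_zero]), add_zero]
  rw [Finset.prod_mul_distrib, Finset.prod_mul_distrib, Finset.prod_mul_distrib,
    prod_fin_eq_prod_range_add x i,
    prod_fin_eq_prod_range_add g i, prod_range_two_mul_add_one, prod_range_two_mul_add_one,
    Finset.prod_range_succ (fun k => x (i + (2 * k) • (1 : Fin (2 * s + 1)) + 1))]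
  refine ⟨∏ k ∈ Finset.range s, g (i + (2 * k + 1) • (1 : Fin (2 * s + 1))), ?_⟩
  nth_rewrite 1 [hcycle]
  simp only [succ_nsmul _ (2 * _), ← add_assoc]
  ac_rfl

section

variable {σ K : Type*} [Field K]

open Classical in
/-- The endomorphism setting the variables in `A` to zero. -/
noncomputable def killVars (A : Set σ) : MvPolynomial σ K →ₐ[K] MvPolynomial σ K :=
  aeval fun a => if a ∈ A then 0 else X a

open Classical in
/-- The homomorphism multiplying the variables in `A` by a new variable `t`. -/
noncomputable def gradeVars (A : Set σ) :
    MvPolynomial σ K →ₐ[K] Polynomial (MvPolynomial σ K) :=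
  aeval fun a => if a ∈ A then Polynomial.C (X a) * Polynomial.X else Polynomial.C (X a)

lemma gradeVars_X_of_mem {A : Set σ} {a : σ} (ha : a ∈ A) :
    gradeVars A (X a : MvPolynomial σ K) = Polynomial.C (X a) * Polynomial.X := by
  simp [gradeVars, ha]

lemma gradeVars_X_of_notMem {A : Set σ} {a : σ} (ha : a ∉ A) :
    gradeVars A (X a : MvPolynomial σ K) = Polynomial.C (X a) := by
  simp [gradeVars, ha]

lemma coeff_zero_gradeVars (A : Set σ) (p : MvPolynomial σ K) :
    (gradeVars A p).coeff 0 = killVars A p := by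
  have h : ((Polynomial.aeval (0 : MvPolynomial σ K)).restrictScalars K).comp (gradeVars A) =
      killVars A := by
    ext a
    by_cases ha : a ∈ A <;> simp [gradeVars, killVars, ha]
  rw [← h]
  simp [Polynomial.coeff_zero_eq_aeval_zero]

lemma ker_killVars (A : Set σ) :
    RingHom.ker (killVars A : MvPolynomial σ K →ₐ[K] MvPolynomial σ K) =
      Ideal.span (X '' A) := by
  apply le_antisymm
  · intro p hp
    have h : (Ideal.Quotient.mkₐ K (Ideal.span (X '' A : Set (MvPolynomial σ K)))).comp
        (killVars A) = Ideal.Quotient.mkₐ K _ := by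
      ext a
      by_cases ha : a ∈ A
      · have : (Ideal.Quotient.mk (Ideal.span (X '' A : Set (MvPolynomial σ K)))) (X a) = 0 :=
          Ideal.Quotient.eq_zero_iff_mem.2 (Ideal.subset_span ⟨a, ha, rfl⟩)
        simp [killVars, ha, this]
      · simp [killVars, ha]
    have hp' := DFunLike.congr_fun h p
    rw [RingHom.mem_ker] at hp
    simp only [AlgHom.comp_apply, hp, map_zero] at hp'
    exact Ideal.Quotient.eq_zero_iff_mem.1 hp'.symm
  · rw [Ideal.span_le]
    rintro _ ⟨a, ha, rfl⟩
    simp [RingHom.mem_ker, killVars, ha]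

lemma X_pow_dvd_gradeVars {A : Set σ} {p : MvPolynomial σ K} {m : ℕ}
    (hp : p ∈ Ideal.span (X '' A) ^ m) : Polynomial.X ^ m ∣ gradeVars A p := by
  rw [← Ideal.mem_span_singleton, ← Ideal.span_singleton_pow]
  have hle : Ideal.span (X '' A : Set (MvPolynomial σ K)) ≤
      (Ideal.span {Polynomial.X}).comap (gradeVars A) := by
    rw [Ideal.span_le]
    rintro _ ⟨a, ha, rfl⟩
    rw [SetLike.mem_coe, Ideal.mem_comap, gradeVars_X_of_mem ha, Ideal.mem_span_singleton]
    exact dvd_mul_left _ _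
  exact (Ideal.le_comap_pow (gradeVars A) m) (Ideal.pow_right_mono hle m hp)

/-- Multiplication by a nonzero polynomial homogeneous of degree `m` in the variables of `A`
raises the order along the ideal generated by `A` by exactly `m`. -/
lemma mem_of_mul_mem_pow_succ {A : Set σ} {p u : MvPolynomial σ K} {m : ℕ} (hu0 : u ≠ 0)
    (hu : gradeVars A u = Polynomial.C u * Polynomial.X ^ m)
    (h : p * u ∈ Ideal.span (X '' A) ^ (m + 1)) : p ∈ Ideal.span (X '' A) := by
  have hd := X_pow_dvd_gradeVars h
  rw [map_mul, hu, ← mul_assoc, pow_succ', mul_dvd_mul_iff_right (by simp),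
    Polynomial.X_dvd_iff, Polynomial.coeff_mul_C, coeff_zero_gradeVars] at hd
  rw [← ker_killVars, RingHom.mem_ker]
  exact (mul_eq_zero.1 hd).resolve_right hu0

end

/-- **Theorem (Step 1, part 2).** For a special odd cycle
`Δ : v_1, F_1, …, v_{2s+1}, F_{2s+1}, v_{2s+2} = v_1` with `s ≥ 1`, facet ideal
`I = I(Δ)`, and `u = ∏_{i=1}^{2s+1} ( x_{v_i} ∏_{j ∈ F_i ∖ {v_i,v_{i+1}}} x_j )`,
one has `I^{s+1} : u = P = (x_{v_1},…,x_{v_{2s+1}})`; in particular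
`P ∈ Ass(I^{s+1})`. -/
theorem specialOddCycle_colon {K : Type*} [Field K] (n s : ℕ) (hs : 1 ≤ s)
    (F : Fin (2 * s + 1) → Finset (Fin n)) (v : Fin (2 * s + 1) → Fin n)
    (hFinj : Function.Injective F)
    (hFcover : ∀ a : Fin n, ∃ i, a ∈ F i)
    (hFincomp : ∀ i j, i ≠ j → ¬ F i ⊆ F j)
    (hvinj : Function.Injective v)
    (hvF : ∀ i, v i ∈ F i ∧ v (i + 1) ∈ F i)
    (hspecial : ∀ i, (Finset.univ.filter fun j => v j ∈ F i).card ≤ 2)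
    (I : Ideal (MvPolynomial (Fin n) K))
    (hI : I = Ideal.span (Set.range fun i => ∏ j ∈ F i, (X j : MvPolynomial (Fin n) K)))
    (P : Ideal (MvPolynomial (Fin n) K))
    (hP : P = Ideal.span (Set.range fun i => (X (v i) : MvPolynomial (Fin n) K)))
    (u : MvPolynomial (Fin n) K)
    (hu : u = ∏ i : Fin (2 * s + 1),
        ((X (v i) : MvPolynomial (Fin n) K) * ∏ j ∈ F i \ {v i, v (i + 1)}, X j)) :
    (I ^ (s + 1)).colon (Ideal.span {u}) = P ∧
    P ∈ associatedPrimes (MvPolynomial (Fin n) K)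
        (MvPolynomial (Fin n) K ⧸ I ^ (s + 1)) := by
  classical
  have hne (i : Fin (2 * s + 1)) : i ≠ i + 1 := by
    have : Fact (1 < 2 * s + 1) := ⟨by omega⟩
    have : Nontrivial (Fin (2 * s + 1)) := Fin.nontrivial_iff_two_le.2 (by omega)
    simp [show s ≠ 0 by omega]
  have hvne (i : Fin (2 * s + 1)) : v i ≠ v (i + 1) := fun h => hne i (hvinj h)
  have hsplit (i : Fin (2 * s + 1)) : (∏ j ∈ F i, (X j : MvPolynomial (Fin n) K)) =
      X (v i) * X (v (i + 1)) * ∏ j ∈ F i \ {v i, v (i + 1)}, X j := by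
    rw [← Finset.prod_pair (hvne i), mul_comm, Finset.prod_sdiff]
    simp [Finset.insert_subset_iff, hvF i]
  have hrest (i : Fin (2 * s + 1)) : ∀ j ∈ F i \ {v i, v (i + 1)}, j ∉ Set.range v := by
    rintro _ hj ⟨k, rfl⟩
    simp only [Finset.mem_sdiff, Finset.mem_insert, Finset.mem_singleton, not_or] at hj
    have hsub : ({k, i, i + 1} : Finset (Fin (2 * s + 1))) ⊆
        Finset.univ.filter fun j => v j ∈ F i := by
      simp [Finset.insert_subset_iff, hvF i, hj.1]
    have hcard := (Finset.card_le_card hsub).trans (hspecial i)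
    have hthree : ({k, i, i + 1} : Finset (Fin (2 * s + 1))).card = 3 :=
      Finset.card_eq_three.2 ⟨k, i, i + 1, fun h => hj.2.1 (h ▸ rfl),
        fun h => hj.2.2 (h ▸ rfl), hne i, rfl⟩
    omega
  have hPA : P = Ideal.span (X '' Set.range v) := by
    rw [hP, ← Set.range_comp]; rfl
  have hu0 : u ≠ 0 := by
    rw [hu]
    simp [Finset.prod_ne_zero_iff]
  have hgrade : gradeVars (Set.range v) u = Polynomial.C u * Polynomial.X ^ (2 * s + 1) := by
    have hg (i : Fin (2 * s + 1)) : gradeVars (Set.range v) ((X (v i) : MvPolynomial (Fin n) K) *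
        ∏ j ∈ F i \ {v i, v (i + 1)}, X j) =
        Polynomial.C (X (v i) * ∏ j ∈ F i \ {v i, v (i + 1)}, X j) * Polynomial.X := by
      rw [map_mul, map_prod, Finset.prod_congr rfl fun j hj => gradeVars_X_of_notMem (hrest i j hj),
        gradeVars_X_of_mem (Set.mem_range_self i), map_mul, map_prod]
      ring
    rw [hu, map_prod, Finset.prod_congr rfl fun i _ => hg i, Finset.prod_mul_distrib, map_prod]
    simp
  have hIP : I ^ (s + 1) ≤ P ^ (2 * s + 1 + 1) := by
    rw [show 2 * s + 1 + 1 = 2 * (s + 1) by ring, pow_mul]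
    refine Ideal.pow_right_mono ?_ _
    rw [hI, Ideal.span_le]
    rintro _ ⟨i, rfl⟩
    have hmem (j : Fin (2 * s + 1)) : X (v j) ∈ P := hP ▸ Ideal.subset_span ⟨j, rfl⟩
    simp only [SetLike.mem_coe, hsplit i, pow_two]
    exact Ideal.mul_mem_right _ _ (Ideal.mul_mem_mul (hmem i) (hmem (i + 1)))
  have hmem_iff (p : MvPolynomial (Fin n) K) : p * u ∈ I ^ (s + 1) ↔ p ∈ P := by
    constructor
    · intro h
      have h' := hIP h
      rw [hPA] at h' ⊢
      exact mem_of_mul_mem_pow_succ hu0 hgrade h'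
    · have hle : P ≤ (I ^ (s + 1)).colon (Ideal.span {u}) := by
        rw [hP, Ideal.span_le]
        rintro _ ⟨i, rfl⟩
        rw [SetLike.mem_coe, Ideal.mem_colon_span_singleton, hu]
        refine Ideal.mem_of_dvd _ (prod_edges_dvd_mul_prod s (fun i => X (v i)) _ i) ?_
        rw [← Finset.card_range (s + 1), ← Finset.prod_const, Finset.card_range]
        refine Ideal.prod_mem_prod fun k _ => ?_
        rw [← hsplit, hI]
        exact Ideal.subset_span ⟨_, rfl⟩
      exact fun hp => Ideal.mem_colon_span_singleton.1 (hle hp)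
  have hcolon : (I ^ (s + 1)).colon (Ideal.span {u}) = P := by
    ext p
    rw [Ideal.mem_colon_span_singleton, hmem_iff]
  have hprime : P.IsPrime := by
    rw [hPA, ← ker_killVars]
    exact RingHom.ker_isPrime _
  refine ⟨hcolon, hprime, Ideal.Quotient.mk (I ^ (s + 1)) u, ?_⟩
  rw [show (⊥ : Submodule _ _).colon {Ideal.Quotient.mk (I ^ (s + 1)) u} = P from ?_,
    hprime.radical]
  ext p
  rw [Submodule.mem_colon_singleton, Submodule.mem_bot, ← hmem_iff,
    ← Ideal.Quotient.eq_zero_iff_mem, map_mul]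
  rfl
end

section
/- Let Δ: v_1, F_1, v_2, F_2, …, v_{2s+1}, F_{2s+1}, v_{2s+2} = v_1 be a special odd cycle with s ≥ 1 and I = I(Δ) its facet ideal. Then for every 1 ≤ m ≤ s, the prime ideal P = (x_{v_1},…,x_{v_{2s+1}}) is not an associated prime of I^m. -/
open MvPolynomial

/-- Weighted König duality on a path with vertices `0, …, n`: there are a vertex cover `c` and a
`b`-matching `e` (with `e k` the multiplicity of the edge joining `k` and `k + 1`) such that the
weight of `c` does not exceed the size of `e`. -/
theorem exists_path_matching_cover (n : ℕ) (b : ℕ → ℕ) :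
    ∃ e c : ℕ → ℕ, (∀ k, n ≤ k → e k = 0) ∧ e 0 ≤ b 0 ∧ (∀ k, e k + e (k + 1) ≤ b (k + 1)) ∧
      (∀ k, c k ≤ 1) ∧ (∀ k < n, 1 ≤ c k + c (k + 1)) ∧
      ∑ k ∈ Finset.range (n + 1), c k * b k ≤ ∑ k ∈ Finset.range n, e k := by
  induction n generalizing b with
  | zero => exact ⟨0, 0, by simp⟩
  | succ n ih =>
    obtain ⟨e, c, he, he0, hmatch, hc, hcover, hle⟩ :=
      ih fun k => if k = 0 then b 1 - min (b 0) (b 1) else b (k + 1)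
    simp only [Finset.sum_range_succ', ↓reduceIte, Nat.add_eq_zero_iff, one_ne_zero, and_false]
      at he0 hmatch hle
    refine ⟨fun
        | 0 => min (b 0) (b 1)
        | k + 1 => e k,
      fun
        | 0 => if c 0 = 1 then 0 else if b 0 ≤ b 1 then 1 else 0
        | 1 => if c 0 = 1 then 1 else if b 0 ≤ b 1 then 0 else 1
        | k + 2 => c (k + 1), ?_, ?_, ?_, ?_, ?_, ?_⟩
    · rintro (_ | k) hk
      · omega
      · exact he k (by omega)
    · exact min_le_left _ _
    · rintro (_ | k)
      · simp only [zero_add]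
        omega
      · exact hmatch k
    · rintro (_ | _ | k)
      · dsimp only; split_ifs <;> simp
      · dsimp only; split_ifs <;> simp
      · exact hc _
    · rintro (_ | _ | k) hk
      · dsimp only; split_ifs <;> simp
      · have h1 := hcover 0 (by omega)
        have h2 := hc 0
        dsimp only
        simp only [zero_add] at h1 ⊢
        split_ifs <;> omega
      · exact hcover (k + 1) (by omega)
    · simp only [Finset.sum_range_succ', zero_add]
      have h2 := hc 0
      have h3 : c 0 = 0 ∨ c 0 = 1 := by omega
      rcases h3 with h3 | h3 <;>
        simp only [h3, zero_ne_one, ↓reduceIte, zero_mul, one_mul] at hle ⊢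
      · split_ifs <;> omega
      · omega

/-- A function with sum at least `m` dominates one with sum exactly `m`. -/
theorem exists_le_sum_eq {ι : Type*} [Fintype ι] [DecidableEq ι] {m : ℕ} (e : ι → ℕ)
    (h : m ≤ ∑ i, e i) : ∃ e' ≤ e, ∑ i, e' i = m := by
  induction m with
  | zero => exact ⟨0, fun _ => Nat.zero_le _, by simp⟩
  | succ m ih =>
    obtain ⟨e', hle, hsum⟩ := ih (by omega)
    obtain ⟨i, -, hi⟩ : ∃ i ∈ Finset.univ, e' i < e i :=
      Finset.exists_lt_of_sum_lt (by omega)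
    refine ⟨e' + Pi.single i 1, fun j => ?_, by simp [Finset.sum_add_distrib, hsum]⟩
    by_cases hj : j = i
    · subst hj; simpa using hi
    · simpa [hj] using hle j

/-- Weak duality between matchings and vertex covers of a cycle. -/
theorem sum_matching_le_cover {N : ℕ} [NeZero N] {a c e : Fin N → ℕ}
    (he : ∀ k, e k + e (k + 1) ≤ a (k + 1)) (hc : ∀ k, 1 ≤ c k + c (k + 1)) :
    ∑ k, e k ≤ ∑ k, c k * a k := by
  have shift (f : Fin N → ℕ) : ∑ k, f (k + 1) = ∑ k, f k := Equiv.sum_comp (Equiv.addRight 1) f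
  calc ∑ k, e k ≤ ∑ k, (c k * e k + c (k + 1) * e k) :=
        Finset.sum_le_sum fun k _ => by nlinarith [hc k]
    _ = ∑ k, c (k + 1) * (e k + e (k + 1)) := by
        simp only [mul_add, Finset.sum_add_distrib, shift fun k => c k * e k]
        exact add_comm _ _
    _ ≤ ∑ k, c (k + 1) * a (k + 1) :=
        Finset.sum_le_sum fun k _ => Nat.mul_le_mul_left _ (he k)
    _ = ∑ k, c k * a k := shift fun k => c k * a k

/-- If the vertex `0` of a cycle has capacity zero and raising any single capacity by one makes a
matching of size `m` possible, then there is a matching of size at least `m` already. -/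
theorem exists_cycle_matching_of_zero {n m : ℕ} (hn : 2 ≤ n) (a : Fin (n + 1) → ℕ) (ha : a 0 = 0)
    (h : ∀ i, ∃ e : Fin (n + 1) → ℕ, ∑ k, e k = m ∧
      ∀ k, e k + e (k + 1) ≤ a (k + 1) + if k + 1 = i then 1 else 0) :
    ∃ e : Fin (n + 1) → ℕ, m ≤ ∑ k, e k ∧ ∀ k, e k + e (k + 1) ≤ a (k + 1) := by
  obtain ⟨e, c, he, he0, hmatch, -, hcover, hle⟩ :=
    exists_path_matching_cover n fun k => if hk : k < n + 1 then a ⟨k, hk⟩ else 0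
  obtain ⟨c', hc', ⟨i, hi⟩, hle'⟩ : ∃ c' : Fin (n + 1) → ℕ, (∀ k, 1 ≤ c' k + c' (k + 1)) ∧
      (∃ i, c' i = 0) ∧ ∑ k, c' k * a k ≤ ∑ k ∈ Finset.range n, e k := by
    rw [Finset.sum_range] at hle
    simp only [Fin.is_lt, ↓reduceDIte, Fin.eta] at hle
    set d : Fin (n + 1) → ℕ := fun k => if k = 0 then 1 else c k with hd
    have hdcover : ∀ k, 1 ≤ d k + d (k + 1) := by
      intro k
      induction k using Fin.lastCases with
      | last => simp [hd]
      | cast k =>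
        have := hcover k k.2
        rw [Fin.coeSucc_eq_succ]
        by_cases hk : k.castSucc = 0
        · simp [hd, hk]
        · simpa [hd, hk] using this
    have hdle : ∑ k, d k * a k ≤ ∑ k ∈ Finset.range n, e k := by
      refine le_trans (Finset.sum_le_sum fun k _ => ?_) hle
      by_cases hk : k = 0
      · simp [hk, ha]
      · simp [hd, hk]
    by_cases hz : ∃ i, d i = 0
    · exact ⟨d, hdcover, hz, hdle⟩
    · push Not at hz
      refine ⟨Function.update d 1 0, fun k => ?_, ⟨1, by simp⟩, ?_⟩
      · by_cases hk : k = 1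
        · subst hk
          have : (1 : Fin (n + 1)) + 1 ≠ 1 := by simp; omega
          rw [Function.update_of_ne this]
          have := hz (1 + 1)
          omega
        · rw [Function.update_of_ne hk]
          have := hz k
          omega
      · refine le_trans (Finset.sum_le_sum fun k _ => Nat.mul_le_mul_right _ ?_) hdle
        by_cases hk : k = 1
        · simp [hk]
        · simp [hk]
  refine ⟨fun k => e k, ?_, fun k => ?_⟩
  · obtain ⟨f, hf, hfa⟩ := h i
    rw [← Finset.sum_range, Finset.sum_range_succ, ← hf]
    have := sum_matching_le_cover (a := fun k => a k + if k = i then 1 else 0) hfa hc'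
    simp only [mul_add, Finset.sum_add_distrib, mul_ite, mul_one, mul_zero, Finset.sum_ite_eq',
      Finset.mem_univ, ↓reduceIte, hi, add_zero] at this
    omega
  · induction k using Fin.lastCases with
    | last => simpa [he n le_rfl] using he0
    | cast k => simpa [Fin.coeSucc_eq_succ, Fin.succ] using hmatch k

/-- On an odd cycle of length `2 * s + 1`, if raising any single capacity by one makes a matching
of size `m ≤ s` possible, then there is a matching of size `m` already. -/
theorem exists_odd_cycle_matching {s m : ℕ} (hs : 1 ≤ s) (hm : m ≤ s) (a : Fin (2 * s + 1) → ℕ)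
    (h : ∀ i, ∃ e : Fin (2 * s + 1) → ℕ, ∑ k, e k = m ∧
      ∀ k, e k + e (k + 1) ≤ a (k + 1) + if k + 1 = i then 1 else 0) :
    ∃ e : Fin (2 * s + 1) → ℕ, ∑ k, e k = m ∧ ∀ k, e k + e (k + 1) ≤ a (k + 1) := by
  suffices ∃ e : Fin (2 * s + 1) → ℕ, m ≤ ∑ k, e k ∧ ∀ k, e k + e (k + 1) ≤ a (k + 1) by
    obtain ⟨e, hsum, he⟩ := this
    obtain ⟨e', hle, hsum'⟩ := exists_le_sum_eq e hsum
    exact ⟨e', hsum', fun k => (add_le_add (hle k) (hle (k + 1))).trans (he k)⟩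
  by_cases hz : ∃ j, a j = 0
  · obtain ⟨j, hj⟩ := hz
    obtain ⟨e, hsum, he⟩ := exists_cycle_matching_of_zero (m := m) (by omega)
      (fun k => a (k + j)) (by simpa using hj) fun i => by
        obtain ⟨e, hsum, he⟩ := h (i + j)
        refine ⟨fun k => e (k + j), ?_, fun k => ?_⟩
        · rw [← hsum]
          exact Equiv.sum_comp (Equiv.addRight j) e
        · have := he (k + j)
          simpa only [add_right_comm k j 1, add_left_inj] using this
    refine ⟨fun k => e (k - j), ?_, fun k => ?_⟩
    · exact hsum.trans_eq (Equiv.sum_comp (Equiv.subRight j) e).symm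
    · simpa [sub_add_eq_add_sub] using he (k - j)
  · push Not at hz
    refine ⟨fun k => k % 2, ?_, fun k => ?_⟩
    · rw [← Finset.sum_range fun k => k % 2]
      refine hm.trans_eq ?_
      clear * -
      induction s with
      | zero => simp
      | succ s ih =>
        rw [show 2 * (s + 1) + 1 = 2 * s + 1 + 1 + 1 by ring, Finset.sum_range_succ,
          Finset.sum_range_succ, ← ih]
        omega
    · have := hz (k + 1)
      induction k using Fin.lastCases with
      | last => simp
      | cast k =>
        rw [Fin.coeSucc_eq_succ] at this ⊢
        simp only [Fin.val_castSucc, Fin.val_succ]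
        omega

/-- Powers of an ideal generated by finitely many monomials. -/
theorem span_range_monomial_pow {σ ι R : Type*} [CommSemiring R] [Fintype ι] [DecidableEq ι]
    (g : ι → σ →₀ ℕ) (m : ℕ) :
    Ideal.span (Set.range fun i => monomial (g i) (1 : R)) ^ m =
      Ideal.span ((fun d => monomial d (1 : R)) ''
        {d | ∃ e : ι → ℕ, ∑ i, e i = m ∧ d = ∑ i, e i • g i}) := by
  induction m with
  | zero =>
    rw [pow_zero, eq_comm, Ideal.one_eq_top, Ideal.eq_top_iff_one]
    exact Ideal.subset_span ⟨0, ⟨0, by simp⟩, by simp⟩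
  | succ m ih =>
    rw [pow_succ, ih, Ideal.span_mul_span']
    congr 1
    ext p
    simp only [Set.mem_mul, Set.mem_image, Set.mem_range, Set.mem_ofPred_eq]
    constructor
    · rintro ⟨_, ⟨_, ⟨e, he, rfl⟩, rfl⟩, _, ⟨i, rfl⟩, rfl⟩
      refine ⟨_, ⟨e + Pi.single i 1, ?_, rfl⟩, ?_⟩
      · simp [Finset.sum_add_distrib, he]
      · simp [add_smul, Finset.sum_add_distrib, monomial_mul, Pi.single_apply, ite_smul]
    · rintro ⟨_, ⟨e, he, rfl⟩, rfl⟩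
      obtain ⟨i, -, hi⟩ : ∃ i ∈ Finset.univ, e i ≠ 0 :=
        Finset.exists_ne_zero_of_sum_ne_zero (by omega)
      obtain ⟨e', rfl⟩ : ∃ e', e = e' + Pi.single i 1 := by
        refine ⟨e - Pi.single i 1, (tsub_add_cancel_of_le fun j => ?_).symm⟩
        by_cases hj : j = i
        · subst hj; simpa using Nat.one_le_iff_ne_zero.2 hi
        · simp [hj]
      refine ⟨_, ⟨_, ⟨e', ?_, rfl⟩, rfl⟩, _, ⟨i, rfl⟩, ?_⟩
      · simpa [Finset.sum_add_distrib] using he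
      · simp [add_smul, Finset.sum_add_distrib, monomial_mul, Pi.single_apply, ite_smul]

/-- Membership in a power of an ideal generated by finitely many monomials. -/
theorem mem_span_range_monomial_pow {σ ι R : Type*} [CommSemiring R] [Fintype ι] [DecidableEq ι]
    (g : ι → σ →₀ ℕ) (m : ℕ) (p : MvPolynomial σ R) :
    p ∈ Ideal.span (Set.range fun i => monomial (g i) (1 : R)) ^ m ↔
      ∀ u ∈ p.support, ∃ e : ι → ℕ, ∑ i, e i = m ∧ ∑ i, e i • g i ≤ u := by
  rw [span_range_monomial_pow, mem_ideal_span_monomial_image]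
  refine forall₂_congr fun u _ => ⟨?_, ?_⟩
  · rintro ⟨_, ⟨e, he, rfl⟩, hle⟩
    exact ⟨e, he, hle⟩
  · rintro ⟨e, he, hle⟩
    exact ⟨_, ⟨e, he, rfl⟩, hle⟩

/-- In a special cycle, the only cycle vertices on the facet `F i` are `v i` and `v (i + 1)`. -/
theorem mem_facet_iff {n N : ℕ} [NeZero N] (hN : 2 ≤ N) {F : Fin N → Finset (Fin n)}
    {v : Fin N → Fin n} (hvF : ∀ i, v i ∈ F i ∧ v (i + 1) ∈ F i)
    (hspecial : ∀ i, (Finset.univ.filter fun j => v j ∈ F i).card ≤ 2) (i j : Fin N) :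
    v j ∈ F i ↔ j = i ∨ j = i + 1 := by
  have hne : i ≠ i + 1 := by
    obtain ⟨N, rfl⟩ := Nat.exists_eq_succ_of_ne_zero (NeZero.ne N)
    simp; omega
  have heq : {i, i + 1} = Finset.univ.filter fun j => v j ∈ F i := by
    refine Finset.eq_of_subset_of_card_le (fun j hj => ?_) ?_
    · simp only [Finset.mem_insert, Finset.mem_singleton] at hj
      rcases hj with rfl | rfl
      · simpa using (hvF j).1
      · simpa using (hvF i).2
    · rw [Finset.card_pair hne]
      exact hspecial i
  simpa using (Finset.ext_iff.1 heq j).symm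

/-- **Theorem (Step 2).** For a special odd cycle
`Δ : v_1, F_1, …, v_{2s+1}, F_{2s+1}, v_{2s+2} = v_1` with `s ≥ 1` and facet ideal
`I = I(Δ)`, the prime `P = (x_{v_1},…,x_{v_{2s+1}})` is not an associated prime of
`I^m` for any `1 ≤ m ≤ s`. -/
theorem specialOddCycle_not_ass_small_powers {K : Type*} [Field K] (n s : ℕ) (hs : 1 ≤ s)
    (F : Fin (2 * s + 1) → Finset (Fin n)) (v : Fin (2 * s + 1) → Fin n)
    (hFinj : Function.Injective F)
    (hFcover : ∀ a : Fin n, ∃ i, a ∈ F i)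
    (hFincomp : ∀ i j, i ≠ j → ¬ F i ⊆ F j)
    (hvinj : Function.Injective v)
    (hvF : ∀ i, v i ∈ F i ∧ v (i + 1) ∈ F i)
    (hspecial : ∀ i, (Finset.univ.filter fun j => v j ∈ F i).card ≤ 2)
    (I : Ideal (MvPolynomial (Fin n) K))
    (hI : I = Ideal.span (Set.range fun i => ∏ j ∈ F i, (X j : MvPolynomial (Fin n) K)))
    (P : Ideal (MvPolynomial (Fin n) K))
    (hP : P = Ideal.span (Set.range fun i => (X (v i) : MvPolynomial (Fin n) K))) :
    ∀ m : ℕ, 1 ≤ m → m ≤ s →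
      P ∉ associatedPrimes (MvPolynomial (Fin n) K)
          (MvPolynomial (Fin n) K ⧸ I ^ m) := by
  intro m _ hms hass
  set g : Fin (2 * s + 1) → Fin n →₀ ℕ := fun i => ∑ j ∈ F i, Finsupp.single j 1 with hg
  have hgapp (i : Fin (2 * s + 1)) (j : Fin n) : g i j = if j ∈ F i then 1 else 0 := by
    simp [hg, Finsupp.finsetSum_apply, Finsupp.single_apply]
  have hI' : I = Ideal.span (Set.range fun i => monomial (g i) (1 : K)) := by
    rw [hI]
    congr 2
    funext i
    rw [hg, monomial_sum_one]
    rfl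
  obtain ⟨-, x, hx⟩ := isAssociatedPrime_iff.1 hass
  obtain ⟨f, rfl⟩ := Ideal.Quotient.mk_surjective x
  have hmem (p : MvPolynomial (Fin n) K) : p ∈ P ↔ p * f ∈ I ^ m := by
    rw [hx, Submodule.mem_colon_singleton, Submodule.mem_bot,
      ← Ideal.Quotient.mk_eq_mk, ← Submodule.Quotient.mk_smul, smul_eq_mul,
      Ideal.Quotient.mk_eq_mk, Ideal.Quotient.eq_zero_iff_mem]
  classical
  set d : Fin n →₀ ℕ := Finsupp.equivFunOnFinite.symm
    fun j => if j ∈ Set.range v then 0 else m with hd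
  have hdP : monomial d (1 : K) ∉ P := by
    have hP' : P = Ideal.span (X '' Set.range v) := by
      rw [hP, ← Set.range_comp]
      rfl
    rw [hP', mem_ideal_span_X_image]
    intro h
    obtain ⟨j, hj, hdj⟩ := h d (by simp)
    exact hdj (by simp only [hd, Finsupp.equivFunOnFinite_symm_apply_apply, if_pos hj])
  rw [hmem, hI', mem_span_range_monomial_pow] at hdP
  push Not at hdP
  obtain ⟨u, hu, hune⟩ := hdP
  have hdu : d ≤ u := by
    by_contra hle
    exact mem_support_iff.1 hu (by rw [coeff_monomial_mul', if_neg hle])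
  have hvertex (e : Fin (2 * s + 1) → ℕ) (k : Fin (2 * s + 1)) :
      (∑ i, e i • g i) (v (k + 1)) = e k + e (k + 1) := by
    have hne : k ≠ k + 1 := by simp; omega
    calc (∑ i, e i • g i) (v (k + 1))
        = ∑ i, if i ∈ ({k, k + 1} : Finset (Fin (2 * s + 1))) then e i else 0 := by
          rw [Finsupp.finsetSum_apply]
          refine Finset.sum_congr rfl fun i _ => ?_
          simp [hgapp, mem_facet_iff (by omega) hvF hspecial, or_comm, eq_comm]
      _ = e k + e (k + 1) := by
          rw [Finset.sum_ite_mem, Finset.univ_inter, Finset.sum_pair hne]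
  obtain ⟨e, hesum, he⟩ := exists_odd_cycle_matching hs hms (fun k => u (v k)) fun i => by
    have hXP : X (v i) * monomial d (1 : K) ∈ P :=
      Ideal.mul_mem_right _ _ (hP ▸ Ideal.subset_span ⟨i, rfl⟩)
    rw [hmem, hI', mem_span_range_monomial_pow, mul_assoc] at hXP
    obtain ⟨e, hesum, he⟩ := hXP (Finsupp.single (v i) 1 + u) (by
      rw [mem_support_iff, coeff_X_mul]
      exact mem_support_iff.1 hu)
    refine ⟨e, hesum, fun k => ?_⟩
    have := he (v (k + 1))
    rw [hvertex] at this
    simpa [Finsupp.single_apply, hvinj.eq_iff, add_comm, eq_comm] using this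
  refine hune e hesum fun j => ?_
  by_cases hj : j ∈ Set.range v
  · obtain ⟨k, rfl⟩ := hj
    have := he (k - 1)
    rw [← hvertex, sub_add_cancel] at this
    exact this
  · calc (∑ i, e i • g i) j ≤ ∑ i, e i := by
          rw [Finsupp.finsetSum_apply]
          refine Finset.sum_le_sum fun i _ => ?_
          rw [Finsupp.smul_apply, hgapp]
          split_ifs <;> simp
      _ = d j := by rw [hesum, hd, Finsupp.equivFunOnFinite_symm_apply_apply, if_neg hj]
      _ ≤ u j := hdu j
end

section
/- Let t ≥ 1 and i > t with i + t ≤ n, and let G be the finite simple graph on vertex set [n] whose edges are all pairs {a,b} with 1 ≤ a < b ≤ n, a ≤ i, and b − a ≥ t (so that I(G) = B_t(x_i x_n)). Then G is connected, G contains an odd cycle, and for every odd cycle C of G one has V(C) ∪ N(C) = [n]. -/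
/-- The (1-based) vertex set `[n] = {1,…,n}`. -/
abbrev Idx (n : ℕ) := {j : ℕ // 1 ≤ j ∧ j ≤ n}

/-- The graph on `[n]` whose edges are all pairs `{a,b}` with `a < b`, `a ≤ i` and
`b - a ≥ t`; its edge ideal is `B_t(x_i x_n)`. -/
def BtGraph (n t i : ℕ) : SimpleGraph (Idx n) :=
  SimpleGraph.fromRel fun a b => (a : ℕ) < (b : ℕ) ∧ (a : ℕ) ≤ i ∧ (a : ℕ) + t ≤ (b : ℕ)

/-- If every edge of a walk switches the truth value of `p`, then the walk has even length
exactly when `p` takes the same value at its two ends. -/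
theorem SimpleGraph.Walk.even_length_iff_of_forall_edge_switch {V : Type*} {G : SimpleGraph V}
    (p : V → Prop) {u v : V} (c : G.Walk u v)
    (h : ∀ x ∈ c.support, ∀ y ∈ c.support, G.Adj x y → (p x ↔ ¬ p y)) :
    Even c.length ↔ (p u ↔ p v) := by
  induction c with
  | nil => simp
  | @cons u v w huv c ih =>
    have hc := ih fun x hx y hy => h x (by simp [hx]) y (by simp [hy])
    have hswitch := h u (by simp) v (by simp) huv
    rw [SimpleGraph.Walk.length_cons, Nat.even_add_one, hc]
    tauto

theorem BtGraph_adj_iff {n t i : ℕ} (ht : 1 ≤ t) (a b : Idx n) :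
    (BtGraph n t i).Adj a b ↔
      ((a : ℕ) ≤ i ∧ (a : ℕ) + t ≤ b) ∨ ((b : ℕ) ≤ i ∧ (b : ℕ) + t ≤ a) := by
  rw [BtGraph, SimpleGraph.fromRel_adj, ne_eq, Subtype.ext_iff]
  omega

theorem BtGraph_connected {n t i : ℕ} (ht : 1 ≤ t) (hti : t < i) (hin : i + t ≤ n) :
    (BtGraph n t i).Connected := by
  let first : Idx n := ⟨1, by omega⟩
  let last : Idx n := ⟨n, by omega⟩
  have hfl : (BtGraph n t i).Adj first last := by
    rw [BtGraph_adj_iff ht]; simp only [first, last]; omega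
  rw [SimpleGraph.connected_iff_exists_forall_reachable]
  refine ⟨first, fun w => ?_⟩
  have hw := w.2
  rcases le_or_gt (w : ℕ) i with h | h
  · have hlw : (BtGraph n t i).Adj last w := by
      rw [BtGraph_adj_iff ht]; simp only [last]; omega
    exact hfl.reachable.trans hlw.reachable
  · have hfw : (BtGraph n t i).Adj first w := by
      rw [BtGraph_adj_iff ht]; simp only [first]; omega
    exact hfw.reachable

theorem BtGraph_exists_odd_cycle {n t i : ℕ} (ht : 1 ≤ t) (hti : t < i) (hin : i + t ≤ n) :
    ∃ (a : Idx n) (c : (BtGraph n t i).Walk a a), c.IsCycle ∧ Odd c.length := by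
  let first : Idx n := ⟨1, by omega⟩
  let mid : Idx n := ⟨i, by omega⟩
  let last : Idx n := ⟨n, by omega⟩
  have hfm : (BtGraph n t i).Adj first mid := by
    rw [BtGraph_adj_iff ht]; simp only [first, mid]; omega
  have hml : (BtGraph n t i).Adj mid last := by
    rw [BtGraph_adj_iff ht]; simp only [mid, last]; omega
  have hlf : (BtGraph n t i).Adj last first := by
    rw [BtGraph_adj_iff ht]; simp only [first, last]; omega
  refine ⟨first, .cons hfm (.cons hml (.cons hlf .nil)), ?_, by simp [Nat.odd_iff]⟩
  have h₁ := hfm.ne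
  have h₂ := hml.ne
  have h₃ := hlf.ne
  simp [SimpleGraph.Walk.cons_isCycle_iff, SimpleGraph.Walk.cons_isPath_iff, h₁, h₂, h₃,
    h₁.symm, h₃.symm]

/-- Every vertex has a neighbour on each odd closed walk: otherwise every edge of the walk would
join a vertex below `w` to one that is not below `w`. -/
theorem BtGraph_exists_adj_of_odd_length {n t i : ℕ} (ht : 1 ≤ t) {a : Idx n}
    (c : (BtGraph n t i).Walk a a) (hodd : Odd c.length) (w : Idx n) :
    ∃ z ∈ c.support, (BtGraph n t i).Adj z w := by
  by_contra! hw
  refine Nat.not_even_iff_odd.mpr hodd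
    ((c.even_length_iff_of_forall_edge_switch (fun z : Idx n => (z : ℕ) < w) ?_).mpr Iff.rfl)
  intro x hx y hy hxy
  have hxw := hw x hx
  have hyw := hw y hy
  rw [BtGraph_adj_iff ht] at hxy hxw hyw
  omega

/-- **Lemma.** Let `t ≥ 1` and `i > t` with `i + t ≤ n`, and let `G` be the graph
on `[n]` whose edges are all pairs `{a,b}` with `a < b`, `a ≤ i` and `b − a ≥ t`.
Then `G` is connected, `G` contains an odd cycle, and for every odd cycle `C` of
`G` one has `V(C) ∪ N(C) = [n]`. -/
theorem BtGraph_odd_cycles_dominating (n t i : ℕ) (ht : 1 ≤ t) (hti : t < i)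
    (hin : i + t ≤ n) :
    (BtGraph n t i).Connected ∧
    (∃ (a : Idx n) (c : (BtGraph n t i).Walk a a), c.IsCycle ∧ Odd c.length) ∧
    (∀ (a : Idx n) (c : (BtGraph n t i).Walk a a), c.IsCycle → Odd c.length →
      ∀ w : Idx n, w ∈ c.support ∨ ∃ z ∈ c.support, (BtGraph n t i).Adj z w) := by
  exact ⟨BtGraph_connected ht hti hin, BtGraph_exists_odd_cycle ht hti hin,
    fun _ c _ hodd w => Or.inr (BtGraph_exists_adj_of_odd_length ht c hodd w)⟩
end
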